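/- arXiv:1611.00258 — 3 statements merged into one kernel-verified Lean document; each statement's English description precedes it below -/
import Mathlib

section
/- In the random lattice path model of length n, the expected number of zeros equals E[Z_n] = (4/(n+1)) Σ_{0≤k<ℓ<⌈n/2⌉} C(n,k)/C(n,ℓ) + [n even]·(1/(n+1))·(2^n/C(n,n/2) − 1) + 1, i.e. (1/(n+1)) Σ_{ℓ=0}^{n} (1/C(n,ℓ)) Σ_{w∈P(n,ℓ)} Z(w) equals this expression. -/
/-- The step value of a lattice path: `true` is an up-step (+1), `false` a down-step (−1). -/
def pathStep (b : Bool) : ℤ := if b then 1 else -1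

/-- Partial sum `s_t(w) = Σ_{i<t} w(i)` of a lattice path of length `n`. -/
def psum {n : ℕ} (w : Fin n → Bool) (t : ℕ) : ℤ :=
  ∑ i ∈ Finset.univ.filter (fun i : Fin n => (i : ℕ) < t), pathStep (w i)

/-- `P(n,ℓ)`: lattice paths of length `n` with exactly `ℓ` down-steps. -/
def paths (n ℓ : ℕ) : Finset (Fin n → Bool) :=
  Finset.univ.filter (fun w => (Finset.univ.filter (fun i => w i = false)).card = ℓ)

/-- `Z(w)`: the number of zeros of the lattice path `w`. -/
def numZeros {n : ℕ} (w : Fin n → Bool) : ℕ :=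
  ((Finset.range (n + 1)).filter (fun t => psum w t = 0)).card

/-- Number of down-steps of a lattice path. -/
def numDown {n : ℕ} (w : Fin n → Bool) : ℕ :=
  (Finset.univ.filter (fun i => w i = false)).card

/-- Extension of a lattice path by a last step. -/
def extendPath {n : ℕ} (w : Fin n → Bool) (b : Bool) : Fin (n + 1) → Bool :=
  Fin.snoc (α := fun _ => Bool) w b

lemma extendPath_castSucc {n : ℕ} (w : Fin n → Bool) (b : Bool) (i : Fin n) :
    extendPath w b i.castSucc = w i :=
  Fin.snoc_castSucc (α := fun _ => Bool) b w i

lemma extendPath_last {n : ℕ} (w : Fin n → Bool) (b : Bool) :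
    extendPath w b (Fin.last n) = b :=
  Fin.snoc_last (α := fun _ => Bool) b w

/-- Total number of zeros over all paths in `P(n,ℓ)`. -/
def totalZeros (n ℓ : ℕ) : ℕ := ∑ w ∈ paths n ℓ, numZeros w

lemma mem_paths {n ℓ : ℕ} {w : Fin n → Bool} : w ∈ paths n ℓ ↔ numDown w = ℓ := by
  simp [paths, numDown]

lemma numDown_extendPath {n : ℕ} (w : Fin n → Bool) (b : Bool) :
    numDown (extendPath w b) = numDown w + if b then 0 else 1 := by
  rw [numDown, numDown, Finset.card_filter, Finset.card_filter, Fin.sum_univ_castSucc]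
  simp only [extendPath_castSucc, extendPath_last]
  cases b <;> rfl

lemma psum_extendPath_of_le {n : ℕ} (w : Fin n → Bool) (b : Bool) {t : ℕ} (ht : t ≤ n) :
    psum (extendPath w b) t = psum w t := by
  simp only [psum, Finset.sum_filter, Fin.sum_univ_castSucc, extendPath_castSucc, Fin.val_castSucc,
    Fin.val_last, not_lt.mpr ht, if_false, add_zero]

lemma psum_length {n : ℕ} (w : Fin n → Bool) : psum w n = n - 2 * (numDown w : ℤ) := by
  have h : ∀ b : Bool, pathStep b = 1 - 2 * (if b = false then 1 else 0 : ℤ) := by decide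
  simp [psum, numDown, h, Finset.sum_sub_distrib, Finset.sum_ite, mul_comm]

lemma numZeros_extendPath {n : ℕ} (w : Fin n → Bool) (b : Bool) :
    numZeros (extendPath w b) =
      numZeros w + if 2 * numDown (extendPath w b) = n + 1 then 1 else 0 := by
  have hlast : psum (extendPath w b) (n + 1) = 0 ↔ 2 * numDown (extendPath w b) = n + 1 := by
    rw [psum_length]
    omega
  simp only [numZeros, Finset.card_filter]
  rw [Finset.sum_range_succ, if_congr hlast rfl rfl]
  congr 1
  refine Finset.sum_congr rfl fun t ht => ?_
  rw [psum_extendPath_of_le w b (Nat.lt_succ_iff.mp (Finset.mem_range.mp ht))]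

lemma sum_extendPath {n : ℕ} (f : (Fin (n + 1) → Bool) → ℕ) :
    ∑ w, f w = ∑ w, f (extendPath w true) + ∑ w, f (extendPath w false) := by
  rw [← (Fin.snocEquiv fun _ : Fin (n + 1) => Bool).sum_comp, Fintype.sum_prod_type]
  simp only [Fintype.sum_bool]
  rfl

lemma sum_paths_eq {n ℓ : ℕ} (f : (Fin n → Bool) → ℕ) :
    ∑ w ∈ paths n ℓ, f w = ∑ w, if numDown w = ℓ then f w else 0 :=
  Finset.sum_filter _ _

lemma sum_paths_succ_zero {n : ℕ} (f : (Fin (n + 1) → Bool) → ℕ) :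
    ∑ w ∈ paths (n + 1) 0, f w = ∑ w ∈ paths n 0, f (extendPath w true) := by
  simp [sum_paths_eq, sum_extendPath, numDown_extendPath]

lemma sum_paths_succ_succ {n ℓ : ℕ} (f : (Fin (n + 1) → Bool) → ℕ) :
    ∑ w ∈ paths (n + 1) (ℓ + 1), f w =
      ∑ w ∈ paths n (ℓ + 1), f (extendPath w true) + ∑ w ∈ paths n ℓ, f (extendPath w false) := by
  simp [sum_paths_eq, sum_extendPath, numDown_extendPath]

lemma card_paths (n ℓ : ℕ) : (paths n ℓ).card = n.choose ℓ := by
  induction n generalizing ℓ with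
  | zero => cases ℓ <;> simp [paths]
  | succ n ih =>
    cases ℓ with
    | zero =>
      rw [Finset.card_eq_sum_ones, sum_paths_succ_zero, ← Finset.card_eq_sum_ones, ih]
      simp
    | succ ℓ =>
      rw [Finset.card_eq_sum_ones, sum_paths_succ_succ, ← Finset.card_eq_sum_ones,
        ← Finset.card_eq_sum_ones, ih, ih, Nat.choose_succ_succ, add_comm]

lemma totalZeros_succ_zero (n : ℕ) : totalZeros (n + 1) 0 = totalZeros n 0 := by
  rw [totalZeros, sum_paths_succ_zero]
  refine Finset.sum_congr rfl fun w hw => ?_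
  simp [numZeros_extendPath, numDown_extendPath, mem_paths.mp hw]

lemma totalZeros_succ_succ (n ℓ : ℕ) :
    totalZeros (n + 1) (ℓ + 1) = totalZeros n (ℓ + 1) + totalZeros n ℓ +
      if 2 * (ℓ + 1) = n + 1 then (n + 1).choose (ℓ + 1) else 0 := by
  have h : ∀ w ∈ paths (n + 1) (ℓ + 1), numZeros w = numZeros (Fin.init w : Fin n → Bool) +
      if 2 * (ℓ + 1) = n + 1 then 1 else 0 := by
    intro w hw
    have hw' : extendPath (Fin.init w : Fin n → Bool) (w (Fin.last n)) = w :=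
      Fin.snoc_init_self (α := fun _ => Bool) w
    conv_lhs => rw [← hw', numZeros_extendPath, hw', mem_paths.mp hw]
  rw [totalZeros, Finset.sum_congr rfl h, Finset.sum_add_distrib, sum_paths_succ_succ]
  simp [extendPath, totalZeros, card_paths]

lemma numDown_not {n : ℕ} (w : Fin n → Bool) : numDown (fun i => !w i) + numDown w = n := by
  have h := Finset.card_filter_add_card_filter_not (s := (Finset.univ : Finset (Fin n)))
    (fun i => w i = true)
  simpa [numDown] using h

lemma numZeros_not {n : ℕ} (w : Fin n → Bool) : numZeros (fun i => !w i) = numZeros w := by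
  have h : ∀ b : Bool, pathStep (!b) = - pathStep b := by decide
  have hpsum : ∀ t, psum (fun i => !w i) t = - psum w t := fun t => by
    simp only [psum, h, Finset.sum_neg_distrib]
  simp only [numZeros, hpsum, neg_eq_zero]

lemma totalZeros_symm {n ℓ : ℕ} (h : ℓ ≤ n) : totalZeros n (n - ℓ) = totalZeros n ℓ := by
  refine Finset.sum_nbij' (fun w i => !w i) (fun w i => !w i) ?_ ?_ ?_ ?_ ?_
  · intro w hw
    have := numDown_not w
    rw [mem_paths] at hw ⊢
    omega
  · intro w hw
    have := numDown_not w
    rw [mem_paths] at hw ⊢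
    omega
  · simp
  · simp
  · intro w _
    exact (numZeros_not w).symm

lemma sum_range_choose_succ (n ℓ : ℕ) :
    ∑ k ∈ Finset.range (ℓ + 1), (n + 1).choose k =
      2 * ∑ k ∈ Finset.range ℓ, n.choose k + n.choose ℓ := by
  rw [Finset.sum_range_succ']
  simp only [Nat.choose_succ_succ, Finset.sum_add_distrib, Nat.succ_eq_add_one]
  have h₁ := Finset.sum_range_succ' (fun k => n.choose k) ℓ
  have h₂ := Finset.sum_range_succ (fun k => n.choose k) ℓ
  simp only [Nat.choose_zero_right] at h₁ ⊢
  omega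

lemma totalZeros_eq {n ℓ : ℕ} (h : 2 * ℓ ≤ n) :
    totalZeros n ℓ = n.choose ℓ + 2 * ∑ k ∈ Finset.range ℓ, n.choose k := by
  induction n generalizing ℓ with
  | zero =>
    obtain rfl : ℓ = 0 := by omega
    decide
  | succ n ih =>
    cases ℓ with
    | zero => simp [totalZeros_succ_zero, ih]
    | succ ℓ =>
      rw [totalZeros_succ_succ, sum_range_choose_succ]
      have h₁ := ih (ℓ := ℓ) (by omega)
      split_ifs with hn
      · have h₂ := totalZeros_symm (n := n) (ℓ := ℓ) (by omega)
        rw [show n - ℓ = ℓ + 1 by omega] at h₂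
        omega
      · have h₂ := ih (ℓ := ℓ + 1) (by omega)
        rw [Finset.sum_range_succ] at h₂
        rw [Nat.choose_succ_succ]
        simp only [Nat.succ_eq_add_one]
        omega

lemma sum_range_of_symm {M : Type*} [AddCommMonoid M] (n : ℕ) (f : ℕ → M)
    (hf : ∀ ℓ ≤ n, f (n - ℓ) = f ℓ) :
    ∑ ℓ ∈ Finset.range (n + 1), f ℓ =
      2 • ∑ ℓ ∈ Finset.range ((n + 1) / 2), f ℓ + if Even n then f (n / 2) else 0 := by
  have key : ∀ m r, m + r = n + 1 → m ≤ r →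
      ∑ ℓ ∈ Finset.range m, f (r + ℓ) = ∑ ℓ ∈ Finset.range m, f ℓ := by
    intro m r hmr _
    rw [← Finset.sum_range_reflect]
    refine Finset.sum_congr rfl fun ℓ hℓ => ?_
    have := Finset.mem_range.mp hℓ
    rw [← hf ℓ (by omega)]
    congr 1
    omega
  rcases Nat.even_or_odd' n with ⟨m, rfl | rfl⟩
  · rw [if_pos (even_two_mul m), show (2 * m + 1) / 2 = m by omega, show 2 * m / 2 = m by omega,
      show 2 * m + 1 = (m + 1) + m by omega, Finset.sum_range_add,
      key m (m + 1) (by omega) (by omega),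
      Finset.sum_range_succ, two_nsmul]
    abel
  · rw [if_neg (by simp), show (2 * m + 1 + 1) / 2 = m + 1 by omega,
      show 2 * m + 1 + 1 = (m + 1) + (m + 1) by omega, Finset.sum_range_add,
      key (m + 1) (m + 1) (by omega) le_rfl, two_nsmul, add_zero]

lemma totalZeros_half {n : ℕ} (h : Even n) : totalZeros n (n / 2) = 2 ^ n := by
  have hs := sum_range_of_symm n n.choose fun ℓ hℓ => Nat.choose_symm hℓ
  obtain ⟨m, rfl⟩ := h.two_dvd
  rw [Nat.sum_range_choose, if_pos h, show (2 * m + 1) / 2 = 2 * m / 2 by omega, smul_eq_mul] at hs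
  rw [totalZeros_eq (by omega), hs, add_comm]

/-- In the random lattice path model of length `n`, the expected number of zeros equals
`(4/(n+1)) Σ_{0≤k<ℓ<⌈n/2⌉} C(n,k)/C(n,ℓ) + [n even]·(1/(n+1))·(2^n/C(n,n/2) − 1) + 1`.
Here `⌈n/2⌉ = (n+1)/2` (natural division). -/
theorem expected_zeros_eq_double_sum (n : ℕ) :
    (1 / ((n : ℝ) + 1)) * ∑ ℓ ∈ Finset.range (n + 1),
      (1 / (n.choose ℓ : ℝ)) * ∑ w ∈ paths n ℓ, (numZeros w : ℝ)
    = (4 / ((n : ℝ) + 1)) * ∑ ℓ ∈ Finset.range ((n + 1) / 2), ∑ k ∈ Finset.range ℓ,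
        (n.choose k : ℝ) / (n.choose ℓ : ℝ)
      + (if Even n then (1 / ((n : ℝ) + 1)) * ((2 : ℝ) ^ n / (n.choose (n / 2) : ℝ) - 1) else 0)
      + 1 := by
  have hsymm : ∀ ℓ ≤ n, (1 / (n.choose (n - ℓ) : ℝ)) * (totalZeros n (n - ℓ) : ℝ) =
      (1 / (n.choose ℓ : ℝ)) * (totalZeros n ℓ : ℝ) := fun ℓ hℓ => by
    rw [totalZeros_symm hℓ, Nat.choose_symm hℓ]
  have hlow : ∀ ℓ ∈ Finset.range ((n + 1) / 2), (1 / (n.choose ℓ : ℝ)) * (totalZeros n ℓ : ℝ) =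
      1 + 2 * ∑ k ∈ Finset.range ℓ, (n.choose k : ℝ) / (n.choose ℓ : ℝ) := by
    intro ℓ hℓ
    have hℓ' := Finset.mem_range.mp hℓ
    have hc : (n.choose ℓ : ℝ) ≠ 0 :=
      Nat.cast_ne_zero.mpr (Nat.choose_pos (by omega)).ne'
    rw [totalZeros_eq (by omega), ← Finset.sum_div]
    push_cast
    field_simp
  have hn : (n : ℝ) + 1 ≠ 0 := by positivity
  have hmain := sum_range_of_symm n
    (fun ℓ => (1 / (n.choose ℓ : ℝ)) * (totalZeros n ℓ : ℝ)) hsymm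
  rw [Finset.sum_congr rfl hlow, Finset.sum_add_distrib, ← Finset.mul_sum] at hmain
  have hcast : ∀ ℓ, ∑ w ∈ paths n ℓ, (numZeros w : ℝ) = (totalZeros n ℓ : ℝ) := fun ℓ =>
    (Nat.cast_sum _ _).symm
  simp only [hcast, hmain, Finset.sum_const, Finset.card_range, nsmul_eq_mul]
  split_ifs with h
  · rw [totalZeros_half h]
    obtain ⟨m, rfl⟩ := h.two_dvd
    rw [show (2 * m + 1) / 2 = m by omega]
    push_cast at hn ⊢
    field_simp
    ring
  · obtain ⟨m, rfl⟩ := Nat.not_even_iff_odd.mp h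
    rw [show (2 * m + 1 + 1) / 2 = m + 1 by omega]
    push_cast at hn ⊢
    field_simp
    ring
end

section
/- For all non-negative integers j < n, Σ_{k=0}^{j} C(n,k) = Σ_{k=0}^{j} 2^k · C(n−k−1, j−k). -/
theorem sum_range_choose_succ_succ (n j : ℕ) :
    ∑ k ∈ Finset.range (j + 2), (n + 1).choose k
      = n.choose (j + 1) + 2 * ∑ k ∈ Finset.range (j + 1), n.choose k := by
  have h := Finset.sum_range_succ' (fun k => n.choose k) (j + 1)
  rw [Finset.sum_range_succ] at h
  rw [Finset.sum_range_succ']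
  simp only [Nat.choose_succ_succ', Finset.sum_add_distrib, Nat.choose_zero_right] at h ⊢
  omega

/-- For all non-negative integers `j < n`,
`Σ_{k=0}^{j} C(n,k) = Σ_{k=0}^{j} 2^k · C(n−k−1, j−k)`. -/
theorem binomial_prefix_sum_identity (j n : ℕ) (h : j < n) :
    ∑ k ∈ Finset.range (j + 1), n.choose k
    = ∑ k ∈ Finset.range (j + 1), 2 ^ k * (n - k - 1).choose (j - k) := by
  induction j generalizing n with
  | zero => simp
  | succ j ih =>
    obtain ⟨n, rfl⟩ : ∃ m, n = m + 1 := ⟨n - 1, by omega⟩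
    rw [sum_range_choose_succ_succ, ih n (by omega), Finset.sum_range_succ' _ (j + 1),
      Finset.mul_sum, add_comm]
    simp [pow_succ', mul_assoc]
end

section
/- Define P : ℕ → ℝ by P_0 = P_1 = 0 and, for n ≥ 2, P_n = (3/2)n + (1/2)H^odd_n − 19/8 − 3[n odd]/(8n) − [n even]/(8(n−1)); define C : ℕ → ℝ by C_0 = C_1 = 0 and, for n ≥ 2, C_n = P_n + (3/C(n,2)) Σ_{k=1}^{n−2} (n−1−k)·C_k. Then, as n → ∞, C_n = (9/5)n log n + A·n + B·log n + Cc + D/n + E/n² + (F·[n even] + G)/n³ + O(1/n⁴), where A = (9/5)γ + (1/5)log 2 − 89/25, B = 67/40, Cc = (67/40)γ + (3/40)log 2 + 637/800, D = 11/16, E = −67/480, F = −1/8, G = 31/400. -/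
open Filter Asymptotics

/-- The odd harmonic number `H^odd_n = Σ_{m=1}^{n} [m odd]/m`. -/
noncomputable def Hodd (n : ℕ) : ℝ :=
  ∑ m ∈ Finset.Icc 1 n, if Odd m then (1 : ℝ) / m else 0

theorem exists_inv_succ_abs_log_sub_log_succ_add_le {n : ℕ} (hn : 1 ≤ n) :
    ∃ x : ℝ, 0 < x ∧ x ≤ 1 / 2 ∧ (n : ℝ) = (1 - x) / x ∧ (n : ℝ) + 1 = 1 / x ∧
      |x + x ^ 2 / 2 + x ^ 3 / 3 + x ^ 4 / 4 + x ^ 5 / 5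
        + (Real.log n - Real.log ((n : ℝ) + 1))| ≤ 2 * x ^ 6 := by
  have hn' : (1 : ℝ) ≤ n := by exact_mod_cast hn
  obtain ⟨x, hx⟩ : ∃ x : ℝ, x = 1 / ((n : ℝ) + 1) := ⟨_, rfl⟩
  have hx0 : 0 < x := by rw [hx]; positivity
  have hx2 : x ≤ 1 / 2 := by
    rw [hx]; exact one_div_le_one_div_of_le (by norm_num) (by linarith)
  refine ⟨x, hx0, hx2, by rw [hx]; field_simp; ring, by rw [hx]; field_simp, ?_⟩
  have hlog : Real.log (1 - x) = Real.log n - Real.log ((n : ℝ) + 1) := by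
    rw [← Real.log_div (by positivity) (by positivity), hx]
    congr 1
    field_simp
    ring
  have h := Real.abs_log_sub_add_sum_range_le (x := x) (by rw [abs_of_pos hx0]; linarith) 5
  rw [hlog, abs_of_pos hx0] at h
  have h2 : x ^ 6 / (1 - x) ≤ 2 * x ^ 6 := by
    rw [div_le_iff₀ (by linarith)]
    nlinarith [pow_pos hx0 6]
  refine le_trans (le_of_eq ?_) (h.trans h2)
  congr 1
  simp only [Finset.sum_range_succ, Finset.sum_range_zero]
  norm_num

theorem abs_div_one_sub_pow_four_le {a x : ℝ} (ha : |a| ≤ 1) (hx : x ≤ 1 / 2) :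
    |a / (1 - x) ^ 4| ≤ 16 := by
  have h1x : 0 < 1 - x := by linarith
  have h4 : (1 / 2 : ℝ) ^ 4 ≤ (1 - x) ^ 4 := pow_le_pow_left₀ (by norm_num) (by linarith) 4
  rw [abs_div, abs_of_pos (pow_pos h1x 4), div_le_iff₀ (pow_pos h1x 4)]
  linarith

theorem abs_le_of_tendsto_zero_of_abs_sub_le {u v : ℕ → ℝ} (hu : Tendsto u atTop (nhds 0))
    (hv : Tendsto v atTop (nhds 0)) (h : ∀ n, |u (n + 1) - u n| ≤ v n - v (n + 1)) (n : ℕ) :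
    |u n| ≤ v n := by
  have hmono : Monotone fun n => u n - v n :=
    monotone_nat_of_le_succ fun n => by linarith [(abs_le.mp (h n)).1]
  have hanti : Antitone fun n => u n + v n :=
    antitone_nat_of_succ_le fun n => by linarith [(abs_le.mp (h n)).2]
  have h1 := hmono.ge_of_tendsto (by simpa using hu.sub hv) n
  have h2 := hanti.le_of_tendsto (by simpa using hu.add hv) n
  exact abs_le.mpr ⟨by linarith, by linarith⟩

/-- The remainder in the asymptotic expansion of the harmonic numbers. -/
noncomputable def harmonicRemainder (n : ℕ) : ℝ :=
  (harmonic n : ℝ) - (Real.log n + Real.eulerMascheroniConstant + 1 / (2 * (n : ℝ))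
    - 1 / (12 * (n : ℝ) ^ 2) + 1 / (120 * (n : ℝ) ^ 4))

theorem abs_harmonicRemainder_succ_sub_le {n : ℕ} (hn : 1 ≤ n) :
    |harmonicRemainder (n + 1) - harmonicRemainder n|
      ≤ 18 / (n : ℝ) ^ 5 - 18 / ((n : ℝ) + 1) ^ 5 := by
  obtain ⟨x, hx0, hx2, hnx, hn1x, hlog⟩ := exists_inv_succ_abs_log_sub_log_succ_add_le hn
  have h1x : 0 < 1 - x := by linarith
  set q : ℝ := (1 / 6 - x / 2 + 13 / 24 * x ^ 2 - x ^ 3 / 5) / (1 - x) ^ 4 with hq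
  have hdiff : harmonicRemainder (n + 1) - harmonicRemainder n
      = (x + x ^ 2 / 2 + x ^ 3 / 3 + x ^ 4 / 4 + x ^ 5 / 5
          + (Real.log n - Real.log ((n : ℝ) + 1))) + x ^ 6 * q := by
    simp only [harmonicRemainder, harmonic_succ]
    push_cast
    rw [hn1x]
    generalize Real.log (n : ℝ) = a
    rw [hnx, hq]
    field_simp
    ring
  have hqle : |q| ≤ 16 := by
    refine abs_div_one_sub_pow_four_le ?_ hx2
    have e2 : x ^ 2 ≤ 1 := by nlinarith
    have e3 : x ^ 3 ≤ 1 := by nlinarith [pow_pos hx0 2]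
    exact abs_le.mpr ⟨by linarith [pow_pos hx0 2], by linarith [pow_pos hx0 3]⟩
  have hstep : 18 * x ^ 6 ≤ 18 / (n : ℝ) ^ 5 - 18 / ((n : ℝ) + 1) ^ 5 := by
    obtain ⟨y, hy⟩ : ∃ y : ℝ, y = x / (1 - x) := ⟨_, rfl⟩
    have hyx : y = x + x * y := by rw [hy]; field_simp; ring
    have hxy : x ≤ y := by rw [hy, le_div_iff₀ h1x]; nlinarith
    have h5 : x ^ 4 * (x + x * x) ≤ y ^ 4 * (x + x * y) := by gcongr
    rw [← hyx] at h5
    have e1 : 18 / (n : ℝ) ^ 5 = 18 * (y ^ 4 * y) := by rw [hnx, hy]; field_simp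
    have e2 : 18 / ((n : ℝ) + 1) ^ 5 = 18 * x ^ 5 := by rw [hn1x]; field_simp
    rw [e1, e2]
    linarith
  rw [hdiff]
  refine (abs_add_le _ _).trans ?_
  rw [abs_mul, abs_of_pos (pow_pos hx0 6)]
  have : x ^ 6 * |q| ≤ x ^ 6 * 16 := by gcongr
  linarith

theorem tendsto_const_div_pow_atTop (c : ℝ) {k : ℕ} (hk : k ≠ 0) :
    Tendsto (fun n : ℕ => c / (n : ℝ) ^ k) atTop (nhds 0) :=
  tendsto_const_nhds.div_atTop ((tendsto_pow_atTop hk).comp tendsto_natCast_atTop_atTop)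

theorem tendsto_harmonicRemainder : Tendsto harmonicRemainder atTop (nhds 0) := by
  have h := (((Real.tendsto_harmonic_sub_log.sub_const Real.eulerMascheroniConstant).sub
    (tendsto_const_div_pow_atTop (1 / 2) one_ne_zero)).add
    (tendsto_const_div_pow_atTop (1 / 12) two_ne_zero)).sub
    (tendsto_const_div_pow_atTop (1 / 120) four_ne_zero)
  simp only [sub_self, add_zero] at h
  refine h.congr fun n => ?_
  simp only [harmonicRemainder]
  ring

theorem abs_harmonicRemainder_le {n : ℕ} (hn : 1 ≤ n) :
    |harmonicRemainder n| ≤ 18 / (n : ℝ) ^ 5 := by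
  obtain ⟨m, rfl⟩ := Nat.exists_eq_add_of_le' hn
  refine abs_le_of_tendsto_zero_of_abs_sub_le (u := fun m => harmonicRemainder (m + 1))
    (v := fun m => 18 / ((m + 1 : ℕ) : ℝ) ^ 5)
    ((tendsto_add_atTop_iff_nat 1).mpr tendsto_harmonicRemainder)
    ((tendsto_add_atTop_iff_nat 1).mpr (tendsto_const_div_pow_atTop 18 (by norm_num)))
    (fun k => ?_) m
  have := abs_harmonicRemainder_succ_sub_le (n := k + 1) (by omega)
  exact_mod_cast this

theorem Hodd_succ (n : ℕ) :
    Hodd (n + 1) = Hodd n + if Odd (n + 1) then 1 / ((n : ℝ) + 1) else 0 := by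
  rw [Hodd, Finset.sum_Icc_succ_top (by omega), Hodd]
  push_cast
  rfl

theorem Hodd_two_mul (m : ℕ) : Hodd (2 * m) = harmonic (2 * m) - (harmonic m : ℝ) / 2 := by
  induction m with
  | zero => simp [Hodd]
  | succ k ih =>
    have h1 : Odd (2 * k + 1) := ⟨k, rfl⟩
    have h2 : ¬ Odd (2 * k + 1 + 1) := by rw [Nat.not_odd_iff_even]; exact ⟨k + 1, by ring⟩
    rw [show 2 * (k + 1) = 2 * k + 1 + 1 by ring, Hodd_succ, Hodd_succ, if_pos h1, if_neg h2, ih]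
    simp only [harmonic_succ]
    push_cast
    field_simp
    ring

theorem abs_Hodd_even_sub_le {n : ℕ} (hn : 1 ≤ n) (he : Even n) :
    |Hodd n - ((Real.log n + Real.log 2 + Real.eulerMascheroniConstant) / 2
      + 1 / (12 * (n : ℝ) ^ 2) - 7 / (120 * (n : ℝ) ^ 4))| ≤ 306 / (n : ℝ) ^ 5 := by
  obtain ⟨m, hm⟩ := he
  obtain rfl : n = 2 * m := by omega
  have hm1 : 1 ≤ m := by omega
  have hm0 : (0 : ℝ) < m := by exact_mod_cast hm1
  have h1 := abs_harmonicRemainder_le hn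
  have h2 := abs_harmonicRemainder_le hm1
  have key : Hodd (2 * m) - ((Real.log (2 * m : ℕ) + Real.log 2
      + Real.eulerMascheroniConstant) / 2 + 1 / (12 * ((2 * m : ℕ) : ℝ) ^ 2)
      - 7 / (120 * ((2 * m : ℕ) : ℝ) ^ 4))
      = harmonicRemainder (2 * m) - harmonicRemainder m / 2 := by
    rw [Hodd_two_mul]
    simp only [harmonicRemainder]
    push_cast
    rw [Real.log_mul two_ne_zero hm0.ne']
    field_simp
    ring
  rw [key]
  have e : (306 : ℝ) / ((2 * m : ℕ) : ℝ) ^ 5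
      = 18 / ((2 * m : ℕ) : ℝ) ^ 5 + 18 / (m : ℝ) ^ 5 / 2 := by
    push_cast
    field_simp
    ring
  rw [e]
  rw [abs_le] at *
  constructor <;> linarith

theorem abs_Hodd_odd_sub_le {n : ℕ} (ho : Odd n) :
    |Hodd n - ((Real.log n + Real.log 2 + Real.eulerMascheroniConstant) / 2
      + 1 / (2 * (n : ℝ)) - 1 / (6 * (n : ℝ) ^ 2) + 1 / (15 * (n : ℝ) ^ 4))|
      ≤ 350 / (n : ℝ) ^ 5 := by
  have hn : 1 ≤ n := ho.pos
  have he : Even (n + 1) := ho.add_one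
  have hO : Hodd (n + 1) = Hodd n := by
    rw [Hodd_succ, if_neg (Nat.not_odd_iff_even.mpr he), add_zero]
  have hs := abs_Hodd_even_sub_le (by omega) he
  rw [hO] at hs
  push_cast at hs
  obtain ⟨x, hx0, hx2, hnx, hn1x, hlog⟩ := exists_inv_succ_abs_log_sub_log_succ_add_le hn
  have h1x : 0 < 1 - x := by linarith
  set q : ℝ := (-(1 / 3) + x / 2 - x ^ 2 / 3 + x ^ 3 / 10) / (1 - x) ^ 4 with hq
  have hqle : |q| ≤ 16 := by
    refine abs_div_one_sub_pow_four_le ?_ hx2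
    have e2 : x ^ 2 ≤ 1 := by nlinarith
    have e3 : x ^ 3 ≤ 1 := by nlinarith [pow_pos hx0 2]
    exact abs_le.mpr ⟨by linarith [pow_pos hx0 3], by linarith [pow_pos hx0 2]⟩
  have e1 : 306 / ((n : ℝ) + 1) ^ 5 = 306 * x ^ 5 := by rw [hn1x]; field_simp
  have hx5 : x ^ 5 ≤ 1 / (n : ℝ) ^ 5 := by
    rw [hnx, div_pow, one_div_div, le_div_iff₀ (pow_pos h1x 5)]
    exact mul_le_of_le_one_right (pow_pos hx0 5).le (pow_le_one₀ h1x.le (by linarith))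
  have hx6 : x ^ 6 ≤ x ^ 5 := pow_le_pow_of_le_one hx0.le (by linarith) (by norm_num)
  rw [e1] at hs
  have hdiff : Hodd n - ((Real.log n + Real.log 2 + Real.eulerMascheroniConstant) / 2
      + 1 / (2 * (n : ℝ)) - 1 / (6 * (n : ℝ) ^ 2) + 1 / (15 * (n : ℝ) ^ 4))
      = (Hodd n - ((Real.log ((n : ℝ) + 1) + Real.log 2 + Real.eulerMascheroniConstant) / 2
        + 1 / (12 * ((n : ℝ) + 1) ^ 2) - 7 / (120 * ((n : ℝ) + 1) ^ 4)))
        - (x + x ^ 2 / 2 + x ^ 3 / 3 + x ^ 4 / 4 + x ^ 5 / 5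
          + (Real.log n - Real.log ((n : ℝ) + 1))) / 2 + x ^ 6 * q := by
    rw [hn1x]
    generalize Real.log (n : ℝ) = a
    generalize Hodd n = b
    rw [hnx, hq]
    field_simp
    ring
  have hq6 : |x ^ 6 * q| ≤ 16 * x ^ 6 := by
    rw [abs_mul, abs_of_pos (pow_pos hx0 6), mul_comm]
    gcongr
  have e : (350 : ℝ) / (n : ℝ) ^ 5 = 350 * (1 / (n : ℝ) ^ 5) := by ring
  rw [hdiff, e]
  rw [abs_le] at *
  constructor <;> linarith [pow_pos hx0 5]

/-- Closed form of the expected comparison count of strategy "Count", valid for `4 ≤ n`. -/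
noncomputable def countCost (n : ℕ) : ℝ :=
  (n : ℝ) * (8 / 5 * (harmonic n : ℝ) + 2 / 5 * Hodd n) - 89 / 25 * (n : ℝ)
    + 8 / 5 * (harmonic n : ℝ) + 3 / 20 * Hodd n - 83 / 800
    + if Even n then 1 / 10 - (1 / ((n : ℝ) - 3) + 3 / ((n : ℝ) - 1)) / 320
      else -(1 / 10) + (3 / ((n : ℝ) - 2) + 1 / (n : ℝ)) / 320

theorem sum_Icc_sub_one_sub_mul_eq_sum_range {C : ℕ → ℝ} (hC0 : C 0 = 0) {n : ℕ} (hn : 2 ≤ n) :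
    ∑ k ∈ Finset.Icc 1 (n - 2), ((n : ℝ) - 1 - (k : ℝ)) * C k
      = ∑ k ∈ Finset.range n, ((n : ℝ) - 1 - (k : ℝ)) * C k := by
  obtain ⟨m, rfl⟩ := Nat.exists_eq_add_of_le' hn
  refine Finset.sum_subset (fun k hk => ?_) fun k hk hk' => ?_
  · simp only [Finset.mem_Icc, Finset.mem_range] at hk ⊢
    omega
  · simp only [Finset.mem_Icc, Finset.mem_range] at hk hk'
    rcases (by omega : k = 0 ∨ k = m + 1) with rfl | rfl
    · rw [hC0, mul_zero]
    · push_cast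
      ring

/-- Taking second differences removes the sum from the dual-pivot quicksort recurrence. -/
theorem dualPivot_second_difference {P C : ℕ → ℝ} (hC0 : C 0 = 0)
    (hC : ∀ n : ℕ, 2 ≤ n →
      C n = P n + (3 / (n.choose 2 : ℝ)) *
        ∑ k ∈ Finset.Icc 1 (n - 2), ((n : ℝ) - 1 - (k : ℝ)) * C k)
    {n : ℕ} (hn : 2 ≤ n) :
    ((n : ℝ) + 2) * ((n : ℝ) + 1) * (C (n + 2) - P (n + 2))
      - 2 * (((n : ℝ) + 1) * n * (C (n + 1) - P (n + 1)))
      + (n : ℝ) * ((n : ℝ) - 1) * (C n - P n) = 6 * C n := by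
  have key : ∀ m : ℕ, 2 ≤ m → (m : ℝ) * ((m : ℝ) - 1) * (C m - P m)
      = 6 * ∑ k ∈ Finset.range m, ((m : ℝ) - 1 - (k : ℝ)) * C k := by
    intro m hm
    have hm' : (2 : ℝ) ≤ m := by exact_mod_cast hm
    have h1 : (m : ℝ) - 1 ≠ 0 := by linarith
    rw [hC m hm, sum_Icc_sub_one_sub_mul_eq_sum_range hC0 hm, Nat.cast_choose_two]
    field_simp
    ring
  have h0 := key n hn
  have h1 := key (n + 1) (by omega)
  have h2 := key (n + 2) (by omega)
  have d : ∀ c : ℝ, ∑ k ∈ Finset.range n, (c - (k : ℝ)) * C k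
      = c * ∑ k ∈ Finset.range n, C k - ∑ k ∈ Finset.range n, (k : ℝ) * C k := by
    intro c
    simp only [sub_mul, Finset.sum_sub_distrib, Finset.mul_sum]
  simp only [Finset.sum_range_succ, d] at h0 h1 h2
  push_cast at h1 h2
  linear_combination h2 - 2 * h1 + h0

theorem eq_countCost {P C : ℕ → ℝ}
    (hP : ∀ n : ℕ, 2 ≤ n →
      P n = (3 / 2) * (n : ℝ) + (1 / 2) * Hodd n - 19 / 8
        - (if Odd n then 3 / (8 * (n : ℝ)) else 0)
        - (if Even n then 1 / (8 * ((n : ℝ) - 1)) else 0))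
    (hC0 : C 0 = 0) (hC1 : C 1 = 0)
    (hC : ∀ n : ℕ, 2 ≤ n →
      C n = P n + (3 / (n.choose 2 : ℝ)) *
        ∑ k ∈ Finset.Icc 1 (n - 2), ((n : ℝ) - 1 - (k : ℝ)) * C k)
    {n : ℕ} (hn : 4 ≤ n) : C n = countCost n := by
  have o1 : Odd 3 := by decide
  have o2 : Odd 5 := by decide
  have o3 : ¬ Odd 4 := by decide
  have e1 : ¬ Even 3 := by decide
  have e2 : ¬ Even 5 := by decide
  have e3 : Even 4 := by decide
  have H2 : Hodd 2 = 1 := by simp [Hodd, Finset.sum_Icc_succ_top]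
  have H3 : Hodd 3 = 4 / 3 := by rw [Hodd_succ, H2, if_pos o1]; norm_num
  have H4 : Hodd 4 = 4 / 3 := by rw [Hodd_succ, H3, if_neg o3]; norm_num
  have H5 : Hodd 5 = 23 / 15 := by rw [Hodd_succ, H4, if_pos o2]; norm_num
  have C2 : C 2 = 1 := by
    rw [hC 2 le_rfl, hP 2 le_rfl, H2]; norm_num
  have C3 : C 3 = 8 / 3 := by
    rw [hC 3 (by norm_num), hP 3 (by norm_num), H3, if_pos o1, if_neg e1]; norm_num [hC1]
  induction n using Nat.strong_induction_on with
  | _ n ih =>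
    rcases (by omega : n = 4 ∨ n = 5 ∨ 6 ≤ n) with rfl | rfl | h6
    · rw [hC 4 (by norm_num), hP 4 (by norm_num), H4, if_neg o3, if_pos e3, countCost,
        H4, if_pos e3]
      norm_num [hC1, C2, harmonic, Finset.sum_range_succ, Finset.sum_Icc_succ_top, Nat.choose]
    · rw [hC 5 (by norm_num), hP 5 (by norm_num), H5, if_pos o2, if_neg e2, countCost,
        H5, if_neg e2]
      norm_num [hC1, C2, C3, harmonic, Finset.sum_range_succ, Finset.sum_Icc_succ_top, Nat.choose]
    · obtain ⟨m, rfl⟩ := Nat.exists_eq_add_of_le' (show 2 ≤ n by omega)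
      have hm : (4 : ℝ) ≤ m := by exact_mod_cast (by omega : 4 ≤ m)
      have hrec := dualPivot_second_difference hC0 hC (show 2 ≤ m by omega)
      have ih0 := ih m (by omega) (by omega)
      have ih1 := ih (m + 1) (by omega) (by omega)
      rw [ih0, ih1, hP m (by omega), hP (m + 1) (by omega), hP (m + 2) (by omega)] at hrec
      have hm3 : (m : ℝ) - 3 ≠ 0 := by linarith
      have hm2 : (m : ℝ) - 2 ≠ 0 := by linarith
      have hm1 : (m : ℝ) - 1 ≠ 0 := by linarith
      have hm0 : (m : ℝ) ≠ 0 := by linarith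
      have hp1 : (m : ℝ) + 1 ≠ 0 := by linarith
      have hp2 : (m : ℝ) + 2 ≠ 0 := by linarith
      have t1 : (m : ℝ) + 1 - 1 = m := by ring
      have t2 : (m : ℝ) + 1 - 2 = m - 1 := by ring
      have t3 : (m : ℝ) + 1 - 3 = m - 2 := by ring
      have t4 : (m : ℝ) + 2 - 1 = m + 1 := by ring
      have t5 : (m : ℝ) + 2 - 2 = m := by ring
      have t6 : (m : ℝ) + 2 - 3 = m - 1 := by ring
      have t7 : (m : ℝ) + 1 + 1 = m + 2 := by ring
      have hmul : ((m : ℝ) + 2) * (m + 1) ≠ 0 := mul_ne_zero hp2 hp1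
      apply mul_left_cancel₀ hmul
      rcases Nat.even_or_odd m with hpar | hpar
      · have a0 : ¬ Odd m := Nat.not_odd_iff_even.mpr hpar
        have a1 : Odd (m + 1) := hpar.add_one
        have b1 : ¬ Even (m + 1) := Nat.not_even_iff_odd.mpr a1
        have b2 : Even (m + 2) := hpar.add even_two
        have a2 : ¬ Odd (m + 2) := Nat.not_odd_iff_even.mpr b2
        simp only [countCost, Hodd_succ, harmonic_succ, if_pos hpar, if_neg a0, if_pos a1,
          if_neg b1, if_pos b2, if_neg a2] at hrec ⊢
        push_cast at hrec ⊢
        simp only [t2, t4, t6, t7] at hrec ⊢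
        generalize (harmonic m : ℝ) = h at *
        generalize Hodd m = o at *
        rw [← sub_eq_zero] at hrec ⊢
        refine Eq.trans ?_ hrec
        field_simp
        ring
      · have a0 : ¬ Even m := Nat.not_even_iff_odd.mpr hpar
        have a1 : Even (m + 1) := hpar.add_one
        have b1 : ¬ Odd (m + 1) := Nat.not_odd_iff_even.mpr a1
        have b2 : Odd (m + 2) := hpar.add_even even_two
        have a2 : ¬ Even (m + 2) := Nat.not_even_iff_odd.mpr b2
        simp only [countCost, Hodd_succ, harmonic_succ, if_pos hpar, if_neg a0, if_pos a1,
          if_neg b1, if_pos b2, if_neg a2] at hrec ⊢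
        push_cast at hrec ⊢
        simp only [t1, t3, t5, t7] at hrec ⊢
        generalize (harmonic m : ℝ) = h at *
        generalize Hodd m = o at *
        rw [← sub_eq_zero] at hrec ⊢
        refine Eq.trans ?_ hrec
        field_simp
        ring

theorem abs_mul_le_div_pow_four {a r c K t : ℝ} (ht : 0 < t) (ha : |a| ≤ c * t)
    (hr : |r| ≤ K / t ^ 5) : |a * r| ≤ c * K / t ^ 4 := by
  rw [abs_mul]
  calc |a| * |r| ≤ (c * t) * (K / t ^ 5) :=
        mul_le_mul ha hr (abs_nonneg _) ((abs_nonneg _).trans ha)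
    _ = c * K / t ^ 4 := by field_simp

theorem one_div_sub_le_two_div {c t : ℝ} (ht : 0 < t) (hc : 2 * c ≤ t) : 1 / (t - c) ≤ 2 / t := by
  rw [div_le_div_iff₀ (by linarith) ht]
  linarith

theorem abs_countCost_sub_le {n : ℕ} (hn : 6 ≤ n) :
    |countCost n -
      ((9 / 5) * (n : ℝ) * Real.log n
        + ((9 / 5) * Real.eulerMascheroniConstant + (1 / 5) * Real.log 2 - 89 / 25) * (n : ℝ)
        + (67 / 40) * Real.log n
        + ((67 / 40) * Real.eulerMascheroniConstant + (3 / 40) * Real.log 2 + 637 / 800)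
        + (11 / 16) / (n : ℝ)
        + (-67 / 480) / (n : ℝ) ^ 2
        + ((-1 / 8) * (if Even n then (1 : ℝ) else 0) + 31 / 400) / (n : ℝ) ^ 3)|
      ≤ 500 / (n : ℝ) ^ 4 := by
  have hn' : (6 : ℝ) ≤ n := by exact_mod_cast hn
  have hn0 : (0 : ℝ) < n := by linarith
  have hm3 : (n : ℝ) - 3 ≠ 0 := by linarith
  have hm2 : (n : ℝ) - 2 ≠ 0 := by linarith
  have hm1 : (n : ℝ) - 1 ≠ 0 := by linarith
  have hr := abs_mul_le_div_pow_four (a := 8 / 5 * ((n : ℝ) + 1)) (c := 2) hn0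
    (by rw [abs_of_pos (by positivity)]; linarith) (abs_harmonicRemainder_le (by omega : 1 ≤ n))
  have hcoef : |2 / 5 * (n : ℝ) + 3 / 20| ≤ 1 * n := by
    rw [abs_of_pos (by positivity)]; linarith
  have hz : 0 < 1 / (n : ℝ) ^ 4 := by positivity
  have hscale : ∀ c : ℝ, c / (n : ℝ) ^ 4 = c * (1 / (n : ℝ) ^ 4) := fun c => by ring
  have htail : ∀ c : ℝ, 2 * c ≤ n →
      0 ≤ 1 / (n : ℝ) ^ 3 * (1 / ((n : ℝ) - c)) ∧
        1 / (n : ℝ) ^ 3 * (1 / ((n : ℝ) - c)) ≤ 2 * (1 / (n : ℝ) ^ 4) := by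
    intro c hc
    have hpos : 0 < (n : ℝ) - c := by linarith
    refine ⟨by positivity, ?_⟩
    calc 1 / (n : ℝ) ^ 3 * (1 / ((n : ℝ) - c)) ≤ 1 / (n : ℝ) ^ 3 * (2 / n) :=
          mul_le_mul_of_nonneg_left (one_div_sub_le_two_div hn0 hc) (by positivity)
      _ = 2 * (1 / (n : ℝ) ^ 4) := by field_simp
  rcases Nat.even_or_odd n with hpar | hpar
  · have hs := abs_mul_le_div_pow_four hn0 hcoef (abs_Hodd_even_sub_le (by omega) hpar)
    obtain ⟨u0, u1⟩ := htail 3 (by linarith)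
    obtain ⟨v0, v1⟩ := htail 1 (by linarith)
    rw [hscale] at hr hs ⊢
    rw [if_pos hpar]
    set s : ℝ := Hodd n - _ with hs_def
    have key : countCost n - ((9 / 5) * (n : ℝ) * Real.log n
        + ((9 / 5) * Real.eulerMascheroniConstant + (1 / 5) * Real.log 2 - 89 / 25) * (n : ℝ)
        + (67 / 40) * Real.log n
        + ((67 / 40) * Real.eulerMascheroniConstant + (3 / 40) * Real.log 2 + 637 / 800)
        + (11 / 16) / (n : ℝ) + (-67 / 480) / (n : ℝ) ^ 2
        + ((-1 / 8) * 1 + 31 / 400) / (n : ℝ) ^ 3)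
        = 8 / 5 * ((n : ℝ) + 1) * harmonicRemainder n + (2 / 5 * (n : ℝ) + 3 / 20) * s
          + 11 / 2400 * (1 / (n : ℝ) ^ 4)
          - 27 / 320 * (1 / (n : ℝ) ^ 3 * (1 / ((n : ℝ) - 3)))
          - 3 / 320 * (1 / (n : ℝ) ^ 3 * (1 / ((n : ℝ) - 1))) := by
      rw [hs_def, countCost, harmonicRemainder, if_pos hpar]
      field_simp
      ring
    rw [key]
    rw [abs_le] at hr hs ⊢
    constructor <;> linarith
  · have hs := abs_mul_le_div_pow_four hn0 hcoef (abs_Hodd_odd_sub_le hpar)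
    have hne : ¬ Even n := Nat.not_even_iff_odd.mpr hpar
    obtain ⟨u0, u1⟩ := htail 2 (by linarith)
    rw [hscale] at hr hs ⊢
    rw [if_neg hne]
    set s : ℝ := Hodd n - _ with hs_def
    have key : countCost n - ((9 / 5) * (n : ℝ) * Real.log n
        + ((9 / 5) * Real.eulerMascheroniConstant + (1 / 5) * Real.log 2 - 89 / 25) * (n : ℝ)
        + (67 / 40) * Real.log n
        + ((67 / 40) * Real.eulerMascheroniConstant + (3 / 40) * Real.log 2 + 637 / 800)
        + (11 / 16) / (n : ℝ) + (-67 / 480) / (n : ℝ) ^ 2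
        + ((-1 / 8) * 0 + 31 / 400) / (n : ℝ) ^ 3)
        = 8 / 5 * ((n : ℝ) + 1) * harmonicRemainder n + (2 / 5 * (n : ℝ) + 3 / 20) * s
          + 7 / 300 * (1 / (n : ℝ) ^ 4)
          + 24 / 320 * (1 / (n : ℝ) ^ 3 * (1 / ((n : ℝ) - 2))) := by
      rw [hs_def, countCost, harmonicRemainder, if_neg hne]
      field_simp
      ring
    rw [key]
    rw [abs_le] at hr hs ⊢
    constructor <;> linarith

/-- The asymptotic expansion of the expected comparison count of dual-pivot quicksort
with strategy "Count": if `P` is the expected partitioning cost of "Count" and `C`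
satisfies the dual-pivot quicksort recurrence, then
`C_n = (9/5)n log n + A·n + B·log n + Cc + D/n + E/n² + (F·[n even]+G)/n³ + O(1/n⁴)`
with the displayed constants (`γ` is the Euler–Mascheroni constant). -/
theorem count_quicksort_asymptotic_cost (P C : ℕ → ℝ)
    (hP0 : P 0 = 0) (hP1 : P 1 = 0)
    (hP : ∀ n : ℕ, 2 ≤ n →
      P n = (3 / 2) * (n : ℝ) + (1 / 2) * Hodd n - 19 / 8
        - (if Odd n then 3 / (8 * (n : ℝ)) else 0)
        - (if Even n then 1 / (8 * ((n : ℝ) - 1)) else 0))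
    (hC0 : C 0 = 0) (hC1 : C 1 = 0)
    (hC : ∀ n : ℕ, 2 ≤ n →
      C n = P n + (3 / (n.choose 2 : ℝ)) *
        ∑ k ∈ Finset.Icc 1 (n - 2), ((n : ℝ) - 1 - (k : ℝ)) * C k) :
    (fun n : ℕ => C n -
      ((9 / 5) * (n : ℝ) * Real.log n
        + ((9 / 5) * Real.eulerMascheroniConstant + (1 / 5) * Real.log 2 - 89 / 25) * (n : ℝ)
        + (67 / 40) * Real.log n
        + ((67 / 40) * Real.eulerMascheroniConstant + (3 / 40) * Real.log 2 + 637 / 800)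
        + (11 / 16) / (n : ℝ)
        + (-67 / 480) / (n : ℝ) ^ 2
        + ((-1 / 8) * (if Even n then (1 : ℝ) else 0) + 31 / 400) / (n : ℝ) ^ 3))
      =O[atTop] fun n : ℕ => 1 / (n : ℝ) ^ 4 := by
  refine IsBigO.of_bound 500 ?_
  filter_upwards [eventually_ge_atTop 6] with n hn
  rw [eq_countCost hP hC0 hC1 hC (by omega), Real.norm_eq_abs, Real.norm_eq_abs,
    abs_of_nonneg (by positivity : (0 : ℝ) ≤ 1 / (n : ℝ) ^ 4), mul_one_div]
  exact abs_countCost_sub_le hn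
end
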